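/- arXiv:2207.00051 — 5 statements merged into one kernel-verified Lean document; each statement's English description precedes it below -/
import Mathlib

section
/- A numerical semigroup S with genus g(S) ≥ 1 is reflective if and only if its set of gaps H(S) is equidistributed modulo g(S), and this holds if and only if H(S) is equidistributed modulo every positive divisor of g(S) (i.e., H(S) is maximally equidistributed). -/
/-- A numerical semigroup: a subset of ℕ containing 0, closed under addition,
with finite complement. -/
def IsNumericalSemigroup (S : Set ℕ) : Prop :=
  0 ∈ S ∧ (∀ a ∈ S, ∀ b ∈ S, a + b ∈ S) ∧ Sᶜ.Finite

/-- The genus: number of gaps. -/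
noncomputable def genus (S : Set ℕ) : ℕ := Sᶜ.ncard

/-- The Frobenius number: the largest gap. -/
noncomputable def frob (S : Set ℕ) : ℕ := sSup Sᶜ

/-- The multiplicity: the smallest positive element. -/
noncomputable def mult (S : Set ℕ) : ℕ := sInf {n ∈ S | 0 < n}

/-- A numerical semigroup is reflective if for each z ∈ {0,...,g-1}
exactly one of z and z + g lies in S, where g is the genus. -/
def Reflective (S : Set ℕ) : Prop :=
  ∀ z < genus S, Xor' (z ∈ S) (z + genus S ∈ S)

/-- A set A is equidistributed modulo m if each residue class mod m contains
the same number of elements of A. -/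
def Equidistributed (A : Set ℕ) (m : ℕ) : Prop :=
  ∀ r₁ < m, ∀ r₂ < m, {x ∈ A | x % m = r₁}.ncard = {x ∈ A | x % m = r₂}.ncard

/-- The submonoid of ℕ generated by A. -/
def gen (A : Set ℕ) : Set ℕ := (AddSubmonoid.closure A : Set ℕ)

/-- The (unique) minimal generating set of a numerical semigroup: nonzero elements
not expressible as a sum of two nonzero elements. -/
def minGens (S : Set ℕ) : Set ℕ :=
  {n ∈ S | n ≠ 0 ∧ ∀ a ∈ S, ∀ b ∈ S, a ≠ 0 → b ≠ 0 → n ≠ a + b}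

/-- The embedding dimension: the cardinality of the minimal generating set. -/
noncomputable def embdim (S : Set ℕ) : ℕ := (minGens S).ncard

/-- The Apéry set of S relative to t: elements s of S with s - t ∉ S. -/
def aperySet (S : Set ℕ) (t : ℕ) : Set ℕ := {s ∈ S | ∀ u ∈ S, s ≠ u + t}

/-- Pseudo-Frobenius numbers: gaps h such that h + s ∈ S for every nonzero s ∈ S. -/
def pseudoFrobenius (S : Set ℕ) : Set ℕ :=
  {h | h ∉ S ∧ ∀ s ∈ S, s ≠ 0 → h + s ∈ S}

/-- Membership of an integer in (the image in ℤ of) a numerical semigroup. -/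
def memZ (S : Set ℕ) (z : ℤ) : Prop := 0 ≤ z ∧ z.toNat ∈ S

/-- Symmetric numerical semigroup. -/
def IsSymmetricNS (S : Set ℕ) : Prop :=
  ∀ z : ℤ, Xor' (memZ S z) (memZ S ((frob S : ℤ) - z))

/-- Pseudo-symmetric numerical semigroup. -/
def IsPseudoSymmetricNS (S : Set ℕ) : Prop :=
  2 ∣ frob S ∧ ∀ z : ℤ, z ≠ (frob S : ℤ) / 2 →
    Xor' (memZ S z) (memZ S ((frob S : ℤ) - z))

/-- Irreducible numerical semigroup. -/
def IsIrreducibleNS (S : Set ℕ) : Prop :=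
  ¬ ∃ T₁ T₂ : Set ℕ, IsNumericalSemigroup T₁ ∧ IsNumericalSemigroup T₂ ∧
    S ⊂ T₁ ∧ S ⊂ T₂ ∧ S = T₁ ∩ T₂

/-- A telescopic sequence a₁,...,a_k (1-indexed) of positive integers. -/
def TelescopicSeq (a : ℕ → ℕ) (k : ℕ) : Prop :=
  (∀ i ∈ Finset.Icc 1 k, 0 < a i) ∧
  ∀ j ∈ Finset.Icc 2 k,
    ((Finset.Icc 1 (j-1)).gcd a / (Finset.Icc 1 j).gcd a) * a j ∈
      gen (a '' Set.Icc 1 (j-1))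

/-- A free numerical semigroup: one generated by (the underlying set of)
a telescopic sequence. -/
def IsFreeNS (S : Set ℕ) : Prop :=
  ∃ (k : ℕ) (a : ℕ → ℕ), TelescopicSeq a k ∧ S = gen (a '' Set.Icc 1 k)

open Classical in
/-- Every gap of a numerical semigroup is less than twice the genus. -/
theorem IsNumericalSemigroup.lt_two_mul_genus {S : Set ℕ} (hS : IsNumericalSemigroup S) {x : ℕ}
    (hx : x ∉ S) : x < 2 * genus S := by
  obtain ⟨-, hadd, hfin⟩ := hS
  set I := Finset.range (x + 1)
  have hle : (I.filter (· ∈ S)).card ≤ (I.filter (· ∉ S)).card := by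
    refine Finset.card_le_card_of_injOn (fun i => x - i) ?_ ?_
    · intro i hi
      simp only [I, Finset.coe_filter, Finset.mem_range, Set.mem_ofPred_eq] at hi ⊢
      refine ⟨by omega, fun h => hx ?_⟩
      have := hadd _ hi.2 _ h
      rwa [Nat.add_sub_cancel' (by omega)] at this
    · intro i hi j hj hij
      simp only [I, Finset.coe_filter, Finset.mem_range, Set.mem_ofPred_eq] at hi hj hij
      omega
  have hgap : (I.filter (· ∉ S)).card ≤ genus S := by
    rw [← Set.ncard_coe_finset, genus]
    exact Set.ncard_le_ncard (fun i hi => (Finset.mem_filter.mp hi).2) hfin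
  have hcard := Finset.card_filter_add_card_filter_not (s := I) (· ∈ S)
  rw [Finset.card_range] at hcard
  omega

/-- The gaps in a residue class modulo the genus are among its two smallest members. -/
theorem IsNumericalSemigroup.gaps_mod_genus {S : Set ℕ} (hS : IsNumericalSemigroup S) {r : ℕ}
    (hr : r < genus S) :
    {x ∈ Sᶜ | x % genus S = r} = {x | (x = r ∨ x = r + genus S) ∧ x ∉ S} := by
  ext x
  simp only [Set.mem_ofPred_eq, Set.mem_compl_iff]
  constructor
  · rintro ⟨hx, hxr⟩
    have hlt := hS.lt_two_mul_genus hx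
    refine ⟨?_, hx⟩
    rcases lt_or_ge x (genus S) with h | h
    · rw [Nat.mod_eq_of_lt h] at hxr
      exact Or.inl hxr
    · rw [Nat.mod_eq_sub_mod h, Nat.mod_eq_of_lt (by omega)] at hxr
      omega
  · rintro ⟨rfl | rfl, hx⟩
    · exact ⟨hx, Nat.mod_eq_of_lt hr⟩
    · exact ⟨hx, by rw [Nat.add_mod_right, Nat.mod_eq_of_lt hr]⟩

/-- Exactly one of `r`, `r + g` is in `S` iff the class of `r` modulo the genus `g` contains
exactly one gap. -/
theorem IsNumericalSemigroup.xor_iff_ncard_gaps_eq_one {S : Set ℕ} (hS : IsNumericalSemigroup S)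
    {r : ℕ} (hr : r < genus S) :
    Xor' (r ∈ S) (r + genus S ∈ S) ↔ {x ∈ Sᶜ | x % genus S = r}.ncard = 1 := by
  have hne : r ≠ r + genus S := by omega
  rw [hS.gaps_mod_genus hr, Set.ncard_eq_one]
  constructor
  · rintro (⟨h₁, h₂⟩ | ⟨h₁, h₂⟩)
    · refine ⟨r + genus S, Set.ext fun x => ?_⟩
      simp only [Set.mem_ofPred_eq, Set.mem_singleton_iff]
      grind
    · refine ⟨r, Set.ext fun x => ?_⟩
      simp only [Set.mem_ofPred_eq, Set.mem_singleton_iff]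
      grind
  · rintro ⟨a, ha⟩
    have h (x) : (x = r ∨ x = r + genus S) ∧ x ∉ S ↔ x = a := Set.ext_iff.mp ha x
    have h₁ := h r
    have h₂ := h (r + genus S)
    have h₃ := h a
    unfold Xor'
    grind

/-- Equidistribution passes to divisors of the modulus. -/
theorem Equidistributed.of_dvd {A : Set ℕ} (hA : A.Finite) {m d : ℕ} (hm : 0 < m) (hd : 0 < d)
    (hdm : d ∣ m) (h : Equidistributed A m) : Equidistributed A d := by
  lift A to Finset ℕ using hA
  have hcoe (n r : ℕ) : {x ∈ (A : Set ℕ) | x % n = r}.ncard = (A.filter (· % n = r)).card := by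
    rw [← Set.ncard_coe_finset, Finset.coe_filter]
    rfl
  simp only [Equidistributed, hcoe] at h ⊢
  have key : ∀ r < d, (A.filter (· % d = r)).card = m / d * (A.filter (· % m = 0)).card := by
    intro r hr
    have hmaps : Set.MapsTo (· % m) (A.filter (· % d = r) : Set ℕ)
        ((Finset.range m).filter (· % d = r) : Set ℕ) := by
      intro x hx
      simp only [Finset.coe_filter, Finset.mem_range, Set.mem_ofPred_eq] at hx ⊢
      exact ⟨Nat.mod_lt _ hm, by rw [Nat.mod_mod_of_dvd _ hdm, hx.2]⟩
    have hcount : ((Finset.range m).filter (· % d = r)).card = m / d := by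
      have := Nat.count_modEq_card m hd r
      rw [Nat.mod_eq_zero_of_dvd hdm, if_neg (Nat.not_lt_zero _), Nat.add_zero,
        Nat.count_eq_card_filter_range] at this
      simpa only [Nat.ModEq, Nat.mod_eq_of_lt hr] using this
    rw [Finset.card_eq_sum_card_fiberwise hmaps, ← hcount, ← smul_eq_mul]
    refine Finset.sum_eq_card_nsmul fun z hz => ?_
    simp only [Finset.mem_filter, Finset.mem_range] at hz
    rw [h 0 hm z hz.1, Finset.filter_filter]
    congr 1
    refine Finset.filter_congr fun x _ => ⟨And.right, fun hx => ⟨?_, hx⟩⟩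
    rw [← hz.2, ← hx, Nat.mod_mod_of_dvd _ hdm]
  intro r₁ h₁ r₂ h₂
  rw [key r₁ h₁, key r₂ h₂]

/-- A numerical semigroup is reflective iff its gaps are equidistributed modulo the genus. -/
theorem IsNumericalSemigroup.reflective_iff_equidistributed {S : Set ℕ}
    (hS : IsNumericalSemigroup S) (hg : 1 ≤ genus S) :
    Reflective S ↔ Equidistributed Sᶜ (genus S) := by
  constructor
  · intro h r₁ h₁ r₂ h₂
    rw [(hS.xor_iff_ncard_gaps_eq_one h₁).mp (h r₁ h₁),
      (hS.xor_iff_ncard_gaps_eq_one h₂).mp (h r₂ h₂)]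
  · intro h z hz
    have hfin (r : ℕ) : {x ∈ Sᶜ | x % genus S = r}.Finite := hS.2.2.subset fun x hx => hx.1
    have hle : {x ∈ Sᶜ | x % genus S = 0}.ncard ≤ 1 := by
      rw [Set.ncard_le_one (hfin 0), hS.gaps_mod_genus hg]
      rintro a ⟨rfl | rfl, ha⟩ b ⟨rfl | rfl, hb⟩
      exacts [rfl, absurd hS.1 ha, absurd hS.1 hb, rfl]
    obtain ⟨x, hx⟩ := Set.nonempty_of_ncard_ne_zero (Nat.one_le_iff_ne_zero.mp hg)
    have hpos : 0 < {y ∈ Sᶜ | y % genus S = x % genus S}.ncard :=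
      (Set.ncard_pos (hfin _)).mpr ⟨x, hx, rfl⟩
    rw [h _ (Nat.mod_lt x hg) 0 hg] at hpos
    rw [hS.xor_iff_ncard_gaps_eq_one hz, h z hz 0 hg]
    omega

theorem stmt1 (S : Set ℕ) (hS : IsNumericalSemigroup S) (hg : 1 ≤ genus S) :
    (Reflective S ↔ Equidistributed Sᶜ (genus S)) ∧
    (Reflective S ↔ ∀ d : ℕ, 0 < d → d ∣ genus S → Equidistributed Sᶜ d) := by
  have key := hS.reflective_iff_equidistributed hg
  exact ⟨key, fun h d hd hdg => (key.mp h).of_dvd hS.2.2 hg hd hdg,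
    fun h => key.mpr (h _ hg dvd_rfl)⟩
end

section
/- Let g be a positive integer and let a be an integer with 2 ≤ a ≤ g + 1 and a ∤ g. Let A = {a} ∪ {g+1, g+2, ..., g+(a−1)}. If z ∈ ⟨A⟩ and g < z ≤ 2g + 1, then z = l·a + (g + i) for some nonnegative integer l and some i ∈ {1, ..., a−1}. -/
/-- An element of the monoid generated by `a` and the interval `[g + 1, g + (a - 1)]` uses
no generator from the interval, exactly one, or at least two. -/
lemma dvd_or_eq_or_le_of_mem_gen {g a z : ℕ}
    (hz : z ∈ gen ({a} ∪ Set.Icc (g + 1) (g + (a - 1)))) :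
    a ∣ z ∨ (∃ l : ℕ, ∃ i ∈ Set.Icc 1 (a - 1), z = l * a + (g + i)) ∨ 2 * g + 2 ≤ z := by
  change z ∈ AddSubmonoid.closure _ at hz
  induction hz using AddSubmonoid.closure_induction with
  | mem x hx =>
    rcases hx with rfl | ⟨hx1, hx2⟩
    · exact Or.inl dvd_rfl
    · exact Or.inr (Or.inl ⟨0, x - g, ⟨by omega, by omega⟩, by omega⟩)
  | zero => exact Or.inl (dvd_zero a)
  | add x y _ _ hx hy =>
    rcases hx with ⟨k, rfl⟩ | ⟨l, i, hi, rfl⟩ | hx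
    · rcases hy with ⟨m, rfl⟩ | ⟨m, j, hj, rfl⟩ | hy
      · exact Or.inl ⟨k + m, by ring⟩
      · exact Or.inr (Or.inl ⟨k + m, j, hj, by ring⟩)
      · exact Or.inr (Or.inr (by omega))
    · rcases hy with ⟨m, rfl⟩ | ⟨m, j, hj, rfl⟩ | hy
      · exact Or.inr (Or.inl ⟨l + m, i, hi, by ring⟩)
      · have hi1 := hi.1
        have hj1 := hj.1
        exact Or.inr (Or.inr (by omega))
      · exact Or.inr (Or.inr (by omega))
    · exact Or.inr (Or.inr (by omega))

theorem stmt3 (g a : ℕ) (hg : 1 ≤ g) (ha2 : 2 ≤ a) (hag : a ≤ g + 1) (hnd : ¬ a ∣ g)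
    (z : ℕ) (hz : z ∈ gen ({a} ∪ Set.Icc (g + 1) (g + (a - 1))))
    (h1 : g < z) (h2 : z ≤ 2 * g + 1) :
    ∃ l : ℕ, ∃ i ∈ Set.Icc 1 (a - 1), z = l * a + (g + i) := by
  rcases dvd_or_eq_or_le_of_mem_gen hz with hdvd | h | h
  · have hmod : (z - g) % a ≠ 0 := fun h0 =>
      hnd ((Nat.dvd_sub_iff_right h1.le hdvd).mp (Nat.dvd_of_mod_eq_zero h0))
    have hlt : (z - g) % a < a := Nat.mod_lt _ (by omega)
    have hdiv := Nat.div_add_mod' (z - g) a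
    exact ⟨(z - g) / a, (z - g) % a, ⟨by omega, by omega⟩, by omega⟩
  · exact h
  · omega
end

section
/- Let S be a numerical semigroup with genus g(S) = g ≥ 1 and multiplicity m(S) = a, and let q = ⌊g/a⌋ and r = g − a·q. Then S is reflective if and only if S = ⟨A⟩ for A = {a, 2g + a − r} ∪ {g+1, g+2, ..., g+(a−1)}, with 2 ≤ a ≤ g + 1 and a ∤ g. -/
theorem IsNumericalSemigroup.mul_mem {S : Set ℕ} (hS : IsNumericalSemigroup S) {a : ℕ}
    (ha : a ∈ S) (k : ℕ) : a * k ∈ S := by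
  induction k with
  | zero => simpa using hS.1
  | succ k ih => exact hS.2.1 _ ih _ ha

/-- All gaps of a reflective numerical semigroup of genus `g` are smaller than `2 * g`. -/
theorem Reflective.mem_of_two_mul_genus_le {S : Set ℕ} (hS : IsNumericalSemigroup S)
    (h : Reflective S) {n : ℕ} (hn : 2 * genus S ≤ n) : n ∈ S := by
  classical
  let f : ℕ → ℕ := fun z => if z ∈ S then z + genus S else z
  have hsub : f '' Set.Iio (genus S) ⊆ Sᶜ := by
    rintro _ ⟨z, hz, rfl⟩
    have hx := h z hz
    by_cases hzS : z ∈ S <;> simp_all [f, Xor']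
  have hinj : Set.InjOn f (Set.Iio (genus S)) := by
    intro x hx y hy hxy
    simp only [Set.mem_Iio] at hx hy
    simp only [f] at hxy
    split_ifs at hxy <;> omega
  have heq : f '' Set.Iio (genus S) = Sᶜ := by
    refine Set.eq_of_subset_of_ncard_le hsub ?_ hS.2.2
    rw [hinj.ncard_image, Set.ncard_Iio_nat]
    exact le_rfl
  by_contra hnS
  have hmem : n ∈ f '' Set.Iio (genus S) := heq ▸ hnS
  obtain ⟨z, hz, rfl⟩ := hmem
  simp only [Set.mem_Iio] at hz
  simp only [f] at hn
  split_ifs at hn <;> omega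

/-- Membership in the semigroup generated by `a`, `g + 1, …, g + (a - 1)` and the least
integer `≥ 2 * g` congruent to `g` modulo `a`. -/
theorem mem_gen_iff {a g : ℕ} (ha : 0 < a) (hag : ¬ a ∣ g) (n : ℕ) :
    n ∈ gen ({a, 2 * g + a - g % a} ∪ Set.Icc (g + 1) (g + (a - 1))) ↔
      a ∣ n ∨ (g ≤ n ∧ ¬ a ∣ n - g) ∨ 2 * g ≤ n := by
  set A : Set ℕ := {a, 2 * g + a - g % a} ∪ Set.Icc (g + 1) (g + (a - 1)) with hA
  have hr : g % a < a := Nat.mod_lt _ ha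
  have hmul : ∀ k, a * k ∈ AddSubmonoid.closure A := fun k => by
    have h := AddSubmonoid.nsmul_mem _ (AddSubmonoid.subset_closure (s := A) (a := a)
      (by simp [hA])) k
    rwa [smul_eq_mul, mul_comm] at h
  change n ∈ AddSubmonoid.closure A ↔ _
  constructor
  · intro h
    induction h using AddSubmonoid.closure_induction with
    | mem x hx =>
      rcases hx with (rfl | rfl) | ⟨h1, h2⟩
      · exact Or.inl dvd_rfl
      · right; right; omega
      · refine Or.inr (Or.inl ⟨by omega, fun hd => ?_⟩)
        have := Nat.le_of_dvd (by omega) hd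
        omega
    | zero => exact Or.inl (dvd_zero a)
    | add x y _ _ hx hy =>
      have key : ∀ x y, a ∣ x → g ≤ y ∧ ¬ a ∣ y - g →
          g ≤ x + y ∧ ¬ a ∣ x + y - g := fun x y hx hy =>
        ⟨by omega, by rw [Nat.add_sub_assoc hy.1, Nat.dvd_add_right hx]; exact hy.2⟩
      rcases hx with hx | hx | hx
      · rcases hy with hy | hy | hy
        · exact Or.inl (dvd_add hx hy)
        · exact Or.inr (Or.inl (key x y hx hy))
        · right; right; omega
      · rcases hy with hy | hy | hy
        · exact Or.inr (Or.inl (add_comm y x ▸ key y x hy hx))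
        · right; right; omega
        · right; right; omega
      · right; right; omega
  · have hcls : g ≤ n ∧ ¬ a ∣ n - g → n ∈ AddSubmonoid.closure A := by
      rintro ⟨h1, h2⟩
      have hpos : (n - g) % a ≠ 0 := fun h => h2 (Nat.dvd_of_mod_eq_zero h)
      have hlt := Nat.mod_lt (n - g) ha
      have hn : n = (g + (n - g) % a) + a * ((n - g) / a) := by
        have := Nat.mod_add_div (n - g) a
        omega
      rw [hn]
      refine add_mem (AddSubmonoid.subset_closure (Or.inr ⟨?_, ?_⟩)) (hmul _) <;> omega
    rintro (⟨k, rfl⟩ | h | h)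
    · exact hmul k
    · exact hcls h
    · by_cases hd : a ∣ n - g
      · obtain ⟨k, hk⟩ := hd
        have hdm := Nat.mod_add_div g a
        have hr0 : g % a ≠ 0 := fun h => hag (Nat.dvd_of_mod_eq_zero h)
        have hlt : g / a < k := by
          refine Nat.lt_of_mul_lt_mul_left (a := a) ?_
          omega
        obtain ⟨j, rfl⟩ := Nat.exists_eq_add_of_lt hlt
        have hn : n = (2 * g + a - g % a) + a * j := by
          have : a * (g / a + j + 1) = a * (g / a) + a * j + a := by ring
          omega
        rw [hn]
        exact add_mem (AddSubmonoid.subset_closure (by simp [hA])) (hmul _)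
      · exact hcls ⟨by omega, hd⟩

/-- The elements of a reflective numerical semigroup in terms of its multiplicity `a` and genus. -/
theorem Reflective.mem_iff {S : Set ℕ} (hS : IsNumericalSemigroup S) (h : Reflective S)
    {a : ℕ} (haS : a ∈ S) (hmin : ∀ n ∈ S, 0 < n → a ≤ n) (ha : 0 < a) (n : ℕ) :
    n ∈ S ↔ a ∣ n ∨ (genus S ≤ n ∧ ¬ a ∣ n - genus S) ∨ 2 * genus S ≤ n := by
  have hbig : ∀ n, 2 * genus S ≤ n → n ∈ S := fun n => h.mem_of_two_mul_genus_le hS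
  have hshift : ∀ n, genus S ≤ n → ¬ a ∣ n - genus S → n ∈ S := by
    intro n h1 h2
    have hpos : (n - genus S) % a ≠ 0 := fun h => h2 (Nat.dvd_of_mod_eq_zero h)
    have hlt := Nat.mod_lt (n - genus S) ha
    have hn : n = (genus S + (n - genus S) % a) + a * ((n - genus S) / a) := by
      have := Nat.mod_add_div (n - genus S) a
      omega
    rw [hn]
    refine hS.2.1 _ ?_ _ (hS.mul_mem haS _)
    by_cases hjg : (n - genus S) % a < genus S
    · rcases h _ hjg with ⟨hj, -⟩ | ⟨hj, -⟩
      · have := hmin _ hj (by omega)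
        omega
      · rwa [add_comm]
    · exact hbig _ (by omega)
  constructor
  · intro hn
    by_contra! hcon
    obtain ⟨h1, h2, h3⟩ := hcon
    by_cases hng : n < genus S
    · rcases h n hng with ⟨-, hj⟩ | ⟨-, hj⟩
      · exact hj (hshift _ (by omega) (by simpa using h1))
      · exact hj hn
    · have hd := h2 (by omega)
      obtain ⟨k, hk⟩ := hd
      rcases h (n - genus S) (by omega) with ⟨-, hj⟩ | ⟨-, hj⟩
      · exact hj (by rwa [Nat.sub_add_cancel (by omega)])
      · exact hj (hk ▸ hS.mul_mem haS k)
  · rintro (⟨k, rfl⟩ | ⟨h1, h2⟩ | h1)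
    · exact hS.mul_mem haS k
    · exact hshift n h1 h2
    · exact hbig n h1

theorem stmt4 (S : Set ℕ) (hS : IsNumericalSemigroup S) (g a q r : ℕ)
    (hg : genus S = g) (hg1 : 1 ≤ g) (ha : mult S = a)
    (hq : q = g / a) (hr : r = g - a * q) :
    Reflective S ↔
      (S = gen ({a, 2 * g + a - r} ∪ Set.Icc (g + 1) (g + (a - 1))) ∧
        2 ≤ a ∧ a ≤ g + 1 ∧ ¬ a ∣ g) := by
  have hrm : r = g % a := by
    have := Nat.mod_add_div g a
    rw [hr, hq]
    omega
  rw [hrm]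
  clear hr hrm hq
  constructor
  · intro h
    have hne : {n ∈ S | 0 < n}.Nonempty :=
      ⟨2 * g, h.mem_of_two_mul_genus_le hS (by omega), by omega⟩
    have hamem : a ∈ S ∧ 0 < a := by
      rw [← ha]
      exact Nat.sInf_mem hne
    have hmin : ∀ n ∈ S, 0 < n → a ≤ n := fun n h1 h2 => by
      rw [← ha]
      exact Nat.sInf_le ⟨h1, h2⟩
    have hgS : g ∉ S := by
      have h0 := h 0 (by omega)
      rw [zero_add, hg] at h0
      rcases h0 with ⟨-, h0⟩ | ⟨-, h0⟩
      · exact h0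
      · exact absurd hS.1 h0
    have hag : ¬ a ∣ g := by
      rintro ⟨k, rfl⟩
      exact hgS (hS.mul_mem hamem.1 k)
    have ha1 : a ≠ 1 := by
      rintro rfl
      exact hag (one_dvd g)
    have hiff := h.mem_iff hS hamem.1 hmin hamem.2
    rw [hg] at hiff
    refine ⟨?_, by have := hamem.2; omega, ?_, hag⟩
    · ext n
      rw [hiff, mem_gen_iff hamem.2 hag]
    · refine hmin _ ((hiff _).2 (Or.inr (Or.inl ⟨by omega, ?_⟩))) (by omega)
      simpa using ha1
  · rintro ⟨hSA, ha2, -, hag⟩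
    have hiff : ∀ n, n ∈ S ↔ a ∣ n ∨ (g ≤ n ∧ ¬ a ∣ n - g) ∨ 2 * g ≤ n := fun n => by
      conv_lhs => rw [hSA]
      exact mem_gen_iff (by omega) hag n
    intro z hz
    rw [hg] at hz ⊢
    by_cases hd : a ∣ z
    · refine Or.inl ⟨(hiff z).2 (Or.inl hd), fun hc => ?_⟩
      rcases (hiff _).1 hc with hc | ⟨-, hc⟩ | hc
      · exact hag ((Nat.dvd_add_right hd).1 hc)
      · exact hc (by simpa using hd)
      · omega
    · refine Or.inr ⟨(hiff _).2 (Or.inr (Or.inl ⟨by omega, by simpa using hd⟩)), fun hc => ?_⟩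
      rcases (hiff _).1 hc with hc | ⟨hc, -⟩ | hc
      · exact hd hc
      · omega
      · omega
end

section
/- Suppose S is a numerical semigroup with embedding dimension e(S) = 2. Then S is reflective if and only if there exists n ∈ ℕ₀ such that either S = ⟨{2, 4n+3}⟩ (in which case g(S) = 2n+1) or S = ⟨{3, 3n+2}⟩ (in which case g(S) = 3n+1). -/
theorem gen_minGens {S : Set ℕ} (hS : IsNumericalSemigroup S) : gen (minGens S) = S := by
  obtain ⟨h0, hadd, -⟩ := hS
  let M : AddSubmonoid ℕ := ⟨⟨S, fun {a b} ha hb => hadd a ha b hb⟩, h0⟩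
  apply Set.Subset.antisymm
  · exact (AddSubmonoid.closure_le (S := M)).2 fun x hx => hx.1
  · intro x
    induction x using Nat.strong_induction_on with
    | _ x ih =>
      intro hx
      by_cases hm : x ∈ minGens S
      · exact AddSubmonoid.subset_closure hm
      · rcases eq_or_ne x 0 with rfl | hx0
        · exact (AddSubmonoid.closure (minGens S)).zero_mem
        · have hsplit : ∃ a ∈ S, ∃ b ∈ S, a ≠ 0 ∧ b ≠ 0 ∧ x = a + b := by
            by_contra! h
            exact hm ⟨hx, hx0, h⟩
          obtain ⟨a, ha, b, hb, ha0, hb0, rfl⟩ := hsplit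
          exact (AddSubmonoid.closure (minGens S)).add_mem
            (ih a (by omega) ha) (ih b (by omega) hb)

theorem mem_gen_pair {a b x : ℕ} : x ∈ gen {a, b} ↔ ∃ p q : ℕ, x = p * a + q * b := by
  simp [gen, AddSubmonoid.mem_closure_pair, eq_comm]

theorem mem_gen_pair_of_lt_two_mul {a b x : ℕ} (hx : x < 2 * b) :
    x ∈ gen {a, b} ↔ a ∣ x ∨ b ≤ x ∧ a ∣ x - b := by
  rw [mem_gen_pair]
  constructor
  · rintro ⟨p, q, rfl⟩
    have hq : q < 2 := by
      by_contra! h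
      nlinarith
    interval_cases q
    · exact Or.inl (by simp)
    · exact Or.inr ⟨by omega, by simp⟩
  · rintro (⟨p, rfl⟩ | ⟨hbx, p, hp⟩)
    · exact ⟨p, 0, by ring⟩
    · exact ⟨p, 1, by rw [mul_comm p]; omega⟩

theorem coprime_of_finite_compl_gen {a b : ℕ} (h : (gen {a, b})ᶜ.Finite) : a.Coprime b := by
  obtain ⟨N, hN⟩ := h.bddAbove
  have hmem : ∀ x, N < x → x ∈ gen {a, b} := fun x hx => by
    by_contra hx'
    exact absurd (hN hx') (by omega)
  have hdvd : ∀ x ∈ gen {a, b}, a.gcd b ∣ x := by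
    intro x hx
    obtain ⟨p, q, rfl⟩ := mem_gen_pair.1 hx
    exact dvd_add ((Nat.gcd_dvd_left a b).mul_left p) ((Nat.gcd_dvd_right a b).mul_left q)
  have h1 := hdvd _ (hmem (N + 1) (by omega))
  have h2 := hdvd _ (hmem (N + 1 + 1) (by omega))
  exact Nat.dvd_one.1 ((Nat.dvd_add_right h1).1 h2)

theorem exists_int_combination {a b : ℕ} (hb : 0 < b) (hab : a.Coprime b) (x : ℤ) :
    ∃ i j : ℤ, 0 ≤ i ∧ i < b ∧ x = i * a + j * b := by
  obtain ⟨u, v, huv⟩ := Nat.isCoprime_iff_coprime.2 hab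
  have hb' : (0 : ℤ) < b := by exact_mod_cast hb
  refine ⟨x * u % b, x * v + x * u / b * a, Int.emod_nonneg _ hb'.ne', Int.emod_lt_of_pos _ hb', ?_⟩
  have := Int.emod_add_mul_ediv (x * u) b
  linear_combination (-x) * huv - (a : ℤ) * this

theorem mem_gen_pair_iff_nonneg {a b x : ℕ} (hb : 0 < b) (hab : a.Coprime b) {i j : ℤ}
    (hi0 : 0 ≤ i) (hib : i < b) (hx : (x : ℤ) = i * a + j * b) :
    x ∈ gen {a, b} ↔ 0 ≤ j := by
  rw [mem_gen_pair]
  constructor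
  · rintro ⟨p, q, rfl⟩
    push_cast at hx
    have hb' : (0 : ℤ) < b := by exact_mod_cast hb
    have hdvd : (b : ℤ) ∣ i - p := by
      refine (Nat.isCoprime_iff_coprime.2 hab).symm.dvd_of_dvd_mul_right (z := (a : ℤ)) ?_
      exact ⟨q - j, by linear_combination (-1 : ℤ) * hx⟩
    have hip : i ≤ p := by
      by_contra! h
      have := Int.le_of_dvd (by omega) hdvd
      omega
    have hqj : ((p : ℤ) - i) * a = (j - q) * b := by linear_combination hx
    have : 0 ≤ (j - q) * b := hqj ▸ mul_nonneg (by omega) (by omega)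
    have := nonneg_of_mul_nonneg_left this hb'
    omega
  · intro hj
    lift i to ℕ using hi0
    lift j to ℕ using hj
    exact ⟨i, j, by exact_mod_cast hx⟩

theorem mem_gen_pair_of_large {a b x : ℕ} (hb : 0 < b) (hab : a.Coprime b)
    (hx : a * b < x + a + b) : x ∈ gen {a, b} := by
  obtain ⟨i, j, hi0, hib, hij⟩ := exists_int_combination hb hab x
  rw [mem_gen_pair_iff_nonneg hb hab hi0 hib hij]
  by_contra! hj
  zify at hx
  nlinarith [mul_nonneg (show (0 : ℤ) ≤ b - 1 - i by omega) (show (0 : ℤ) ≤ a by omega),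
    mul_nonneg (show (0 : ℤ) ≤ -1 - j by omega) (show (0 : ℤ) ≤ b by omega)]

theorem mem_gen_pair_symm {a b x y : ℕ} (hb : 0 < b) (hab : a.Coprime b)
    (hxy : x + y + a + b = a * b) : x ∈ gen {a, b} ↔ y ∉ gen {a, b} := by
  obtain ⟨i, j, hi0, hib, hij⟩ := exists_int_combination hb hab x
  zify at hxy
  have hy : (y : ℤ) = (b - 1 - i) * a + (-1 - j) * b := by linear_combination hxy - hij
  rw [mem_gen_pair_iff_nonneg hb hab hi0 hib hij,
    mem_gen_pair_iff_nonneg hb hab (by omega) (by omega) hy]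
  omega

theorem two_mul_genus_gen_pair {a b : ℕ} (ha : 2 ≤ a) (hlt : a < b) (hab : a.Coprime b) :
    2 * genus (gen {a, b}) + a + b = a * b + 1 := by
  classical
  have hle : a + b ≤ a * b := by nlinarith
  obtain ⟨F, hF⟩ := Nat.exists_eq_add_of_le hle
  have hb : 0 < b := by omega
  have hsymm : ∀ x ≤ F, (x ∈ gen {a, b} ↔ F - x ∉ gen {a, b}) := fun x hx =>
    mem_gen_pair_symm hb hab (by omega)
  let A := (Finset.range (F + 1)).filter (· ∈ gen {a, b})
  let B := (Finset.range (F + 1)).filter (· ∉ gen {a, b})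
  have hB : genus (gen {a, b}) = B.card := by
    rw [genus, ← Set.ncard_coe_finset]
    congr 1
    ext x
    simp only [Set.mem_compl_iff, B, Finset.coe_filter, Finset.mem_range, Set.mem_ofPred_eq]
    refine ⟨fun hx => ⟨?_, hx⟩, fun hx => hx.2⟩
    by_contra! h
    exact hx (mem_gen_pair_of_large hb hab (by omega))
  have hAB : A.card = B.card := by
    refine Finset.card_nbij' (F - ·) (F - ·) ?_ ?_ ?_ ?_
    · intro x hx
      simp only [A, B, Finset.coe_filter, Finset.mem_range, Set.mem_ofPred_eq] at hx ⊢
      exact ⟨by omega, (hsymm x (by omega)).1 hx.2⟩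
    · intro x hx
      simp only [A, B, Finset.coe_filter, Finset.mem_range, Set.mem_ofPred_eq] at hx ⊢
      refine ⟨by omega, ?_⟩
      have := hsymm x (by omega)
      tauto
    all_goals
      intro x hx
      simp only [A, B, Finset.coe_filter, Finset.mem_range, Set.mem_ofPred_eq] at hx
      simp only
      omega
  have hsum : A.card + B.card = F + 1 := by
    simpa [A, B] using Finset.card_filter_add_card_filter_not (s := Finset.range (F + 1))
      (· ∈ gen {a, b})
  omega

theorem genus_le_of_reflective {a b : ℕ} (ha : 2 ≤ a) (hlt : a < b) (hab : a.Coprime b)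
    (hrefl : ∀ z w, z + w + 1 = genus (gen {a, b}) → z ∈ gen {a, b} → w ∈ gen {a, b}) :
    genus (gen {a, b}) ≤ b := by
  have hg := two_mul_genus_gen_pair ha hlt hab
  by_contra! hbg
  obtain ⟨d, hd⟩ := Nat.exists_eq_add_of_lt hbg
  obtain ⟨i, j, rfl⟩ := mem_gen_pair.1
    (hrefl b d (by omega) (mem_gen_pair.2 ⟨0, 1, by simp⟩))
  obtain ⟨e, he⟩ : ∃ e, (i + 1) * a + e + 1 = genus (gen {a, b}) :=
    ⟨j * b + (b - a), by rw [add_mul, one_mul]; omega⟩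
  have heS := hrefl _ _ he (mem_gen_pair.2 ⟨i + 1, 0, by simp⟩)
  have hrep : (e : ℤ) = (b - 1 : ℤ) * a + (j + 1 - a) * b := by
    zify at hd he
    linear_combination he + hd
  rw [mem_gen_pair_iff_nonneg (by omega) hab (by omega) (by omega) hrep] at heS
  nlinarith

theorem stmt12 (S : Set ℕ) (hS : IsNumericalSemigroup S) (he : embdim S = 2) :
    Reflective S ↔
      ∃ n : ℕ, (S = gen {2, 4 * n + 3} ∧ genus S = 2 * n + 1) ∨
        (S = gen {3, 3 * n + 2} ∧ genus S = 3 * n + 1) := by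
  constructor
  · intro hR
    obtain ⟨a, b, ha, hlt, rfl⟩ : ∃ a b, 2 ≤ a ∧ a < b ∧ S = gen {a, b} := by
      obtain ⟨a, b, hne, hmin⟩ := Set.ncard_eq_two.1 he
      have hSgen := (gen_minGens hS).symm
      rw [hmin] at hSgen
      wlog hlt : a < b generalizing a b
      · exact this b a hne.symm (hmin.trans (Set.pair_comm a b))
          (hSgen.trans (by rw [Set.pair_comm])) (by omega)
      refine ⟨a, b, ?_, hlt, hSgen⟩
      have haM : a ∈ minGens S := by simp [hmin]
      have hbM : b ∈ minGens S := by simp [hmin]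
      by_contra! h
      obtain rfl : a = 1 := by have := haM.2.1; omega
      have hpred : b - 1 ∈ S := by
        rw [hSgen]
        exact mem_gen_pair.2 ⟨b - 1, 0, by simp⟩
      exact hbM.2.2 1 haM.1 (b - 1) hpred (by omega) (by omega) (by omega)
    have hab := coprime_of_finite_compl_gen hS.2.2
    have hg := two_mul_genus_gen_pair ha hlt hab
    have hrefl : ∀ z w, z + w + 1 = genus (gen {a, b}) → z ∈ gen {a, b} → w ∈ gen {a, b} := by
      intro z w hzw hz
      have hx := hR z (by omega)
      have hs := mem_gen_pair_symm (x := w) (y := z + genus (gen {a, b})) (by omega) hab (by omega)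
      simp only [Xor', Xor] at hx
      tauto
    have hgb := genus_le_of_reflective ha hlt hab hrefl
    have hgpos : 0 < genus (gen {a, b}) := by nlinarith
    obtain ⟨i, j, hij⟩ := mem_gen_pair.1
      (hrefl 0 (genus (gen {a, b}) - 1) (by omega) (mem_gen_pair.2 ⟨0, 0, by simp⟩))
    obtain rfl : j = 0 := by
      by_contra hj
      have := Nat.le_mul_of_pos_left b (Nat.pos_of_ne_zero hj)
      omega
    have ha3 : a ≤ 3 := by
      by_contra! h
      nlinarith
    interval_cases a
    · refine ⟨i, Or.inl ⟨?_, by omega⟩⟩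
      rw [show b = 4 * i + 3 by omega]
    · refine ⟨i, Or.inr ⟨?_, by omega⟩⟩
      rw [show b = 3 * i + 2 by omega]
  · rintro ⟨n, ⟨rfl, hg⟩ | ⟨rfl, hg⟩⟩ <;> intro z hz <;> rw [hg] at hz ⊢ <;>
      simp only [Xor', Xor] <;>
      rw [mem_gen_pair_of_lt_two_mul (by omega), mem_gen_pair_of_lt_two_mul (by omega)] <;>
      omega
end

section
/- Suppose S = ⟨{a, ha+d, ha+2d, ..., ha+(k−1)d}⟩ (with a, h, d, k positive integers) is a reflective numerical semigroup with genus g(S) = g. Then one of the following holds: (1) S = ⟨{1}⟩ = ℕ₀ and g = 0; (2) S = ⟨{2, 2g+1}⟩ with g odd; (3) S = ⟨{3, g+1}⟩ with g ≡ 1 (mod 3); (4) S = ⟨{3, g+2, 2g+1}⟩ with g ≡ 2 (mod 3); or (5) S = ⟨{g+1, g+2, ..., 2g+1}⟩. -/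
theorem add_mem_gen {A : Set ℕ} {x y : ℕ} (hx : x ∈ gen A) (hy : y ∈ gen A) :
    x + y ∈ gen A :=
  AddSubmonoid.add_mem _ hx hy

theorem subset_gen {A : Set ℕ} {x : ℕ} (hx : x ∈ A) : x ∈ gen A :=
  AddSubmonoid.subset_closure hx

theorem mul_mem_gen {A : Set ℕ} {x : ℕ} (hx : x ∈ gen A) (n : ℕ) : x * n ∈ gen A := by
  have := AddSubmonoid.nsmul_mem (AddSubmonoid.closure A) hx n
  rwa [smul_eq_mul, mul_comm] at this

theorem gen_subset_of_forall_mem {A B : Set ℕ} (h : ∀ x ∈ A, x ∈ gen B) : gen A ⊆ gen B :=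
  fun _ hx => (AddSubmonoid.closure_le (S := AddSubmonoid.closure B)).2 h hx

theorem eq_zero_or_le_of_mem_gen {A : Set ℕ} {m : ℕ} (hA : ∀ x ∈ A, m ≤ x) {x : ℕ}
    (hx : x ∈ gen A) : x = 0 ∨ m ≤ x := by
  induction hx using AddSubmonoid.closure_induction with
  | mem x hx => exact Or.inr (hA x hx)
  | zero => exact Or.inl rfl
  | add x y _ _ ihx ihy => omega

/-- An element of `gen A` is zero, a generator, or a sum of two nonzero elements. -/
theorem mem_gen_cases {A : Set ℕ} {x : ℕ} (hx : x ∈ gen A) :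
    x = 0 ∨ x ∈ A ∨ ∃ y ∈ gen A, ∃ z ∈ gen A, y ≠ 0 ∧ z ≠ 0 ∧ x = y + z := by
  induction hx using AddSubmonoid.closure_induction with
  | mem x hx => exact Or.inr (Or.inl hx)
  | zero => exact Or.inl rfl
  | add x y hx hy ihx ihy =>
    by_cases hx0 : x = 0
    · simpa [hx0] using ihy
    by_cases hy0 : y = 0
    · simpa [hy0] using ihx
    exact Or.inr (Or.inr ⟨x, hx, y, hy, hx0, hy0, rfl⟩)

theorem Reflective.mem_of_two_mul_genus_le_s13 {S : Set ℕ} (hrefl : Reflective S)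
    (hfin : Sᶜ.Finite) {x : ℕ} (hx : 2 * genus S ≤ x) : x ∈ S := by
  classical
  by_contra hxS
  let f : ℕ → ℕ := fun z => if z ∈ S then z + genus S else z
  have hsub : f '' Set.Iio (genus S) ⊆ Sᶜ := by
    rintro _ ⟨z, hz, rfl⟩
    have hz' := hrefl z hz
    simp only [f]
    split_ifs with hzS
    · rcases hz' with h | h
      · exact h.2
      · exact absurd hzS h.2
    · exact hzS
  have hinj : Set.InjOn f (Set.Iio (genus S)) := by
    intro y hy z hz hyz
    simp only [Set.mem_Iio] at hy hz
    simp only [f] at hyz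
    split_ifs at hyz <;> omega
  have hcard : Sᶜ.ncard ≤ (f '' Set.Iio (genus S)).ncard := by
    rw [hinj.ncard_image, ← Finset.coe_Iio, Set.ncard_coe_finset, Nat.card_Iio]
    exact le_rfl
  have heq := Set.eq_of_subset_of_ncard_le hsub hcard hfin
  have hxf : x ∈ f '' Set.Iio (genus S) := heq ▸ hxS
  obtain ⟨z, hz, rfl⟩ := hxf
  simp only [Set.mem_Iio] at hz
  simp only [f] at hx
  split_ifs at hx <;> omega

/-- The semigroup generated by `g + 1, …, 2 * g + 1` contains every integer above `g`. -/
theorem mem_gen_Icc_of_lt {g n : ℕ} (hn : g < n) : n ∈ gen (Set.Icc (g + 1) (2 * g + 1)) := by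
  induction n using Nat.strong_induction_on with
  | _ n ih =>
    by_cases h : n ≤ 2 * g + 1
    · exact subset_gen ⟨hn, h⟩
    · have := add_mem_gen (ih (n - (g + 1)) (by omega) (by omega))
        (subset_gen (show g + 1 ∈ Set.Icc (g + 1) (2 * g + 1) from ⟨le_rfl, by omega⟩))
      rwa [Nat.sub_add_cancel (by omega)] at this

/-- No semigroup generated by a generalized arithmetic sequence with first term `a ≥ 4` consists
of the multiples of `a` below `g`, the integers `g + z` with `z < g` and `a ∤ z`, and all integers
from `2 * g` on. -/
theorem not_generalized_arithmetic {a g h d k : ℕ} {S : Set ℕ} (ha : 4 ≤ a) (hag : a < g)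
    (hgen : S = gen ({a} ∪ (fun i => h * a + i * d) '' Set.Icc 1 (k - 1)))
    (hpos : ∀ x ∈ S, x = 0 ∨ a ≤ x) (hgS : ¬ a ∣ g)
    (hlow : ∀ x ∈ S, x ≤ g → a ∣ x)
    (hhigh : ∀ z < g, ¬ a ∣ z → z + g ∈ S) (hgap : ∀ z < g, a ∣ z → z + g ∉ S)
    (hlarge : ∀ x, 2 * g ≤ x → x ∈ S) : False := by
  have hAP : ∀ i, 1 ≤ i → i ≤ k - 1 → h * a + i * d ∈ S := fun i h1 h2 => by
    rw [hgen]
    exact subset_gen (Or.inr ⟨i, ⟨h1, h2⟩, rfl⟩)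
  have hcases : ∀ x ∈ S, ¬ a ∣ x →
      (∀ y ∈ S, ∀ z ∈ S, y ≠ 0 → z ≠ 0 → x = y + z → False) →
      ∃ i, 1 ≤ i ∧ i ≤ k - 1 ∧ x = h * a + i * d := by
    intro x hx hax hsum
    rw [hgen] at hx
    rcases mem_gen_cases hx with h0 | hA | ⟨y, hy, z, hz, hy0, hz0, hxyz⟩
    · exact absurd (h0 ▸ dvd_zero a) hax
    · rcases hA with hA | ⟨i, ⟨h1, h2⟩, rfl⟩
      · exact absurd (dvd_of_eq hA.symm) hax
      · exact ⟨i, h1, h2, rfl⟩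
    · rw [← hgen] at hy hz
      exact (hsum y hy z hz hy0 hz0 hxyz).elim
  have hmin : ∀ r, 1 ≤ r → r < a → ¬ a ∣ g + r →
      ∃ i, 1 ≤ i ∧ i ≤ k - 1 ∧ g + r = h * a + i * d := by
    intro r hr1 hra hdiv
    refine hcases _ ?_ hdiv ?_
    · rw [add_comm]
      exact hhigh r (by omega) (Nat.not_dvd_of_pos_of_lt (by omega) hra)
    · intro y hy z hz hy0 hz0 hxyz
      have := hpos y hy
      have := hpos z hz
      exact hdiv (hxyz ▸ dvd_add (hlow y hy (by omega)) (hlow z hz (by omega)))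
  have hdvd : ∀ {r s c : ℕ}, c ∣ g + r → c ∣ g + s → c ∣ (g + s) - (g + r) :=
    fun h1 h2 => Nat.dvd_sub h2 h1
  have hnd : ∀ r s, a ∣ g + r → r < s → s < r + a → ¬ a ∣ g + s := by
    intro r s hr hrs hsa hs
    have := Nat.le_of_dvd (by omega) (hdvd hr hs)
    omega
  have hstep : ∀ r c, 1 ≤ r → r + c < a → ¬ a ∣ g + r → ¬ a ∣ g + (r + c) → d ∣ c := by
    intro r c hr hrc h1 h2
    obtain ⟨i, -, -, hi⟩ := hmin r hr (by omega) h1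
    obtain ⟨j, -, -, hj⟩ := hmin (r + c) (by omega) hrc h2
    have : i * d + c = j * d := by omega
    exact (Nat.dvd_add_right (dvd_mul_left d i)).1 (this ▸ dvd_mul_left d j)
  have hd : d ≠ 1 := by
    rintro rfl
    have hne : 1 ≤ k - 1 ∧ (¬ a ∣ g + 1 → h * a ≤ g) ∧ h * a ≤ g + 1 := by
      by_cases h1 : a ∣ g + 1
      · obtain ⟨i, hi1, hi2, hi⟩ := hmin 2 (by omega) (by omega) (hnd 1 2 h1 (by omega) (by omega))
        exact ⟨by omega, fun h => absurd h1 h, by omega⟩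
      · obtain ⟨i, hi1, hi2, hi⟩ := hmin 1 le_rfl (by omega) h1
        exact ⟨by omega, fun _ => by omega, by omega⟩
    obtain ⟨hk, hle, hle'⟩ := hne
    have hfirst : g < h * a := by
      by_contra hcon
      have hlt : h * a ≠ g := fun he => hgS (he ▸ dvd_mul_left a h)
      have hmem := hlow _ (hAP 1 le_rfl hk) (by omega)
      have := (Nat.dvd_add_right (dvd_mul_left a h)).1 hmem
      have := Nat.le_of_dvd (by omega) this
      omega
    have h1 : a ∣ g + 1 := by
      by_contra hcon
      exact absurd (hle hcon) (by omega)
    have hg1 : ¬ a ∣ 2 * g + 1 := by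
      intro hcon
      have : 2 * g + 1 = (g + 1) + g := by omega
      rw [this] at hcon
      exact hgS ((Nat.dvd_add_right h1).1 hcon)
    have hsplit : ∀ y ∈ S, ∀ z ∈ S, y ≠ 0 → y ≤ g → 2 * g + 1 = y + z → False := by
      intro y hy z hz hy0 hyg hxyz
      have hay := hlow y hy hyg
      have hz' : z = (g + 1 - y) + g := by omega
      exact hgap (g + 1 - y) (by have := hpos y hy; omega) (Nat.dvd_sub h1 hay) (hz' ▸ hz)
    obtain ⟨i, -, hi2, hi⟩ := hcases (2 * g + 1) (hlarge _ (by omega)) hg1 (by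
      intro y hy z hz hy0 hz0 hxyz
      by_cases hyg : y ≤ g
      · exact hsplit y hy z hz hy0 hyg hxyz
      · exact hsplit z hz y hy hz0 (by omega) (by omega))
    have hmem := hAP (g + a - h * a) (by omega) (by omega)
    have : h * a + (g + a - h * a) * 1 = a + g := by omega
    exact hgap a hag dvd_rfl (this ▸ hmem)
  have hone : ∀ r, 1 ≤ r → r + 1 < a → ¬ a ∣ g + r → a ∣ g + (r + 1) := by
    intro r hr hra h1
    by_contra h2
    exact hd (Nat.dvd_one.1 (hstep r 1 hr hra h1 h2))
  by_cases h1 : a ∣ g + 1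
  · exact hnd 1 3 h1 (by omega) (by omega)
      (hone 2 (by omega) (by omega) (hnd 1 2 h1 (by omega) (by omega)))
  have h2 : a ∣ g + 2 := hone 1 le_rfl (by omega) h1
  have h3 := hnd 2 3 h2 (by omega) (by omega)
  by_cases ha4 : a = 4
  · subst ha4
    have hd2 := hstep 1 2 le_rfl (by omega) h1 h3
    have : d = 2 := by
      have := Nat.le_of_dvd (by omega) hd2
      have : d ≠ 0 := by rintro rfl; simp at hd2
      omega
    subst this
    obtain ⟨i, -, -, hi⟩ := hmin 1 le_rfl (by omega) h1
    omega
  · exact hnd 2 4 h2 (by omega) (by omega) (hone 3 (by omega) (by omega) h3)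

theorem stmt13 (S : Set ℕ) (hS : IsNumericalSemigroup S)
    (a h d k : ℕ) (ha : 0 < a) (hh : 0 < h) (hd : 0 < d) (hk : 0 < k)
    (hgen : S = gen ({a} ∪ (fun i => h * a + i * d) '' Set.Icc 1 (k - 1)))
    (hrefl : Reflective S) (g : ℕ) (hg : genus S = g) :
    (S = gen {1} ∧ g = 0) ∨
    (S = gen {2, 2 * g + 1} ∧ g % 2 = 1) ∨
    (S = gen {3, g + 1} ∧ g % 3 = 1) ∨
    (S = gen {3, g + 2, 2 * g + 1} ∧ g % 3 = 2) ∨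
    S = gen (Set.Icc (g + 1) (2 * g + 1)) := by
  obtain ⟨h0, hadd, hfin⟩ := hS
  have hlarge : ∀ x, 2 * g ≤ x → x ∈ S := fun x hx =>
    hrefl.mem_of_two_mul_genus_le_s13 hfin (hg ▸ hx)
  have hxor : ∀ z < g, (z ∈ S ↔ z + g ∉ S) := by
    intro z hz
    have := hrefl z (hg ▸ hz)
    rw [hg] at this
    exact xor_iff_iff_not.1 this
  have haS : a ∈ S := hgen ▸ subset_gen (Or.inl rfl)
  have hmul : ∀ n, a * n ∈ S := fun n => by
    have := mul_mem_gen (hgen ▸ haS) n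
    rwa [← hgen] at this
  have hpos : ∀ x ∈ S, x = 0 ∨ a ≤ x := by
    intro x hx
    rw [hgen] at hx
    refine eq_zero_or_le_of_mem_gen ?_ hx
    rintro y (rfl | ⟨i, -, rfl⟩)
    · exact le_rfl
    · exact le_add_right (Nat.le_mul_of_pos_left a hh)
  have hsub : ∀ B : Set ℕ, (∀ x ∈ B, x ∈ S) → gen B ⊆ S := by
    intro B hB
    rw [hgen] at hB ⊢
    exact gen_subset_of_forall_mem hB
  rcases Nat.eq_zero_or_pos g with hg0 | hg0
  · refine Or.inl ⟨Set.Subset.antisymm (fun x _ => ?_) (hsub _ fun x _ => hlarge x (by omega)), hg0⟩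
    simpa using mul_mem_gen (subset_gen (Set.mem_singleton 1)) x
  have hgS : g ∉ S := by simpa using (hxor 0 hg0).1 h0
  have hag' : ¬ a ∣ g := by
    rintro ⟨n, rfl⟩
    exact hgS (hmul n)
  rcases Nat.lt_or_ge g a with hga | hag
  · refine Or.inr (Or.inr (Or.inr (Or.inr (Set.Subset.antisymm (fun x hx => ?_) (hsub _ ?_)))))
    · rcases hpos x hx with rfl | hx
      · exact AddSubmonoid.zero_mem _
      · exact mem_gen_Icc_of_lt (by omega)
    · rintro x ⟨hx1, hx2⟩
      by_cases hx : 2 * g ≤ x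
      · exact hlarge x hx
      · by_contra hxS
        have := (hxor (x - g) (by omega)).2 (by rwa [Nat.sub_add_cancel (by omega)])
        have := hpos _ this
        omega
  have hag : a < g := lt_of_le_of_ne hag fun h => hag' (dvd_of_eq h)
  have hres : ∀ r, 1 ≤ r → r < a → r + g ∈ S := by
    intro r hr hra
    by_contra hcon
    have := hpos r ((hxor r (by omega)).2 hcon)
    omega
  have hlow' : ∀ x ∈ S, x < g → a ∣ x := by
    intro x hx hxg
    by_contra hcon
    have hr := hres (x % a) (by
      rcases Nat.eq_zero_or_pos (x % a) with h | h
      · exact absurd (Nat.dvd_of_mod_eq_zero h) hcon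
      · exact h) (Nat.mod_lt _ ha)
    have hsum := hadd _ hr _ (hmul (x / a))
    have heq : x % a + g + a * (x / a) = x + g := by
      have := Nat.mod_add_div x a
      omega
    exact (hxor x hxg).1 hx (heq ▸ hsum)
  have hlow : ∀ x ∈ S, x ≤ g → a ∣ x := fun x hx hxg =>
    hlow' x hx (lt_of_le_of_ne hxg fun h => hgS (h ▸ hx))
  have hhigh : ∀ z < g, ¬ a ∣ z → z + g ∈ S := by
    intro z hz haz
    by_contra hcon
    exact haz (hlow z ((hxor z hz).2 hcon) hz.le)
  have hgap : ∀ z < g, a ∣ z → z + g ∉ S := by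
    rintro z hz ⟨n, rfl⟩
    exact (hxor _ hz).1 (hmul n)
  have hcase : ∀ x ∈ S, a ∣ x ∨ (g < x ∧ x < 2 * g ∧ ¬ a ∣ x - g) ∨ 2 * g ≤ x := by
    intro x hx
    by_cases h1 : x ≤ g
    · exact Or.inl (hlow x hx h1)
    by_cases h2 : 2 * g ≤ x
    · exact Or.inr (Or.inr h2)
    refine Or.inr (Or.inl ⟨by omega, by omega, fun hdiv => ?_⟩)
    exact hgap (x - g) (by omega) hdiv (by rwa [Nat.sub_add_cancel (by omega)])
  have hprog : ∀ {B : Set ℕ} {m b x : ℕ}, m ∈ B → b ∈ gen B → b ≤ x → m ∣ x - b → x ∈ gen B := by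
    rintro B m b x hm hb hbx ⟨n, hn⟩
    have := add_mem_gen hb (mul_mem_gen (subset_gen hm) n)
    rwa [show b + m * n = x by omega] at this
  have hzero : ∀ B : Set ℕ, 0 ∈ gen B := fun B => AddSubmonoid.zero_mem _
  obtain rfl | rfl | rfl | ha4 : a = 1 ∨ a = 2 ∨ a = 3 ∨ 4 ≤ a := by omega
  · exact absurd (one_dvd g) hag'
  · refine Or.inr (Or.inl ⟨Set.Subset.antisymm (fun x hx => ?_) (hsub _ ?_), by omega⟩)
    · by_cases h2 : 2 ∣ x
      · exact hprog (m := 2) (by simp) (hzero _) (Nat.zero_le x) (by simpa using h2)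
      · have := hcase x hx
        exact hprog (m := 2) (b := 2 * g + 1) (by simp) (subset_gen (by simp)) (by omega)
          (by omega)
    · rintro x (rfl | rfl)
      · exact haS
      · exact hlarge _ (by omega)
  · obtain hg3 | hg3 : g % 3 = 1 ∨ g % 3 = 2 := by omega
    · refine Or.inr (Or.inr (Or.inl ⟨Set.Subset.antisymm (fun x hx => ?_) (hsub _ ?_), hg3⟩))
      · have := hcase x hx
        have hb : g + 1 ∈ gen {3, g + 1} := subset_gen (by simp)
        obtain h3 | h3 | h3 : x % 3 = 0 ∨ x % 3 = 1 ∨ x % 3 = 2 := by omega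
        · exact hprog (m := 3) (by simp) (hzero _) (Nat.zero_le x) (by omega)
        · exact hprog (m := 3) (by simp) (add_mem_gen hb hb) (by omega) (by omega)
        · exact hprog (m := 3) (by simp) hb (by omega) (by omega)
      · rintro x (rfl | rfl)
        · exact haS
        · rw [add_comm]
          exact hres 1 le_rfl (by omega)
    · refine Or.inr (Or.inr (Or.inr (Or.inl
        ⟨Set.Subset.antisymm (fun x hx => ?_) (hsub _ ?_), hg3⟩)))
      · have := hcase x hx
        obtain h3 | h3 | h3 : x % 3 = 0 ∨ x % 3 = 1 ∨ x % 3 = 2 := by omega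
        · exact hprog (m := 3) (by simp) (hzero _) (Nat.zero_le x) (by omega)
        · exact hprog (m := 3) (b := g + 2) (by simp) (subset_gen (by simp)) (by omega)
            (by omega)
        · exact hprog (m := 3) (b := 2 * g + 1) (by simp) (subset_gen (by simp)) (by omega)
            (by omega)
      · rintro x (rfl | rfl | rfl)
        · exact haS
        · rw [add_comm]
          exact hres 2 (by omega) (by omega)
        · exact hlarge _ (by omega)
  · exact (not_generalized_arithmetic ha4 hag hgen hpos hag' hlow hhigh hgap hlarge).elim
end
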